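/- For all complex a with Re(a) ≥ 0 and a not a nonpositive half-integer shift avoiding poles, Appell's series satisfies F₁(2a; 1−3a, 4a−1; 2a+1/2; −1/80, 5/32) = (2^{6a}/5^{3a}) · √π · Γ(2a+1/2) / Γ(a+1/2)². -/

import Mathlib

open scoped Nat

/-- Pochhammer symbol (rising factorial) on the complex numbers. -/
noncomputable def cpoch (a : ℂ) (n : ℕ) : ℂ := ∏ i ∈ Finset.range n, (a + i)

/-- Appell's hypergeometric series F₁(α; β₁, β₂; γ; x, y) as a complex double series. -/
noncomputable def appellF1 (α β₁ β₂ γ x y : ℂ) : ℂ :=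
  ∑' p : ℕ × ℕ,
    cpoch α (p.1 + p.2) * cpoch β₁ p.1 * cpoch β₂ p.2 /
      (cpoch γ (p.1 + p.2) * (p.1 ! : ℂ) * (p.2 ! : ℂ)) * x ^ p.1 * y ^ p.2

open MeasureTheory

lemma cpoch_succ (b : ℂ) (n : ℕ) : cpoch b (n+1) = cpoch b n * (b + n) := by
  simp [cpoch, Finset.prod_range_succ]

lemma cpoch_zero (b : ℂ) : cpoch b 0 = 1 := by simp [cpoch]

lemma cpoch_norm_le (b : ℂ) (N : ℕ) (hb : ‖b‖ ≤ N + 1) (m : ℕ) :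
    ‖cpoch b m / (m ! : ℂ)‖ ≤ ((m + N).choose N : ℝ) := by
  have h : ‖cpoch b m‖ ≤ ((N+1).ascFactorial m : ℝ) := by
    induction m with
    | zero => simp [cpoch_zero]
    | succ k ih =>
      rw [cpoch_succ, norm_mul, Nat.ascFactorial_succ, mul_comm]
      push_cast
      gcongr
      refine (norm_add_le _ _).trans ?_
      simp only [Complex.norm_natCast]
      linarith
  rw [Nat.ascFactorial_eq_factorial_mul_choose] at h
  rw [norm_div, Complex.norm_natCast, div_le_iff₀ (by positivity), add_comm m N, mul_comm]
  rw [← Nat.choose_symm_add] at h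
  exact_mod_cast h

lemma binom_hasSum (b z : ℂ) (hz : ‖z‖ < 1) :
    HasSum (fun n : ℕ => cpoch b n / (n ! : ℂ) * z ^ n) ((1 - z) ^ (-b)) := by
  have h := (Complex.one_div_one_sub_cpow_hasFPowerSeriesOnBall_zero b).hasSum
    (y := z) (by simpa [← ofReal_norm] using hz)
  simp only [FormalMultilinearSeries.ofScalars_apply_eq, zero_add] at h
  rw [Complex.cpow_neg, ← one_div]
  suffices hh : (fun n : ℕ => cpoch b n / (n ! : ℂ) * z ^ n) =
      fun n : ℕ => Ring.choose (b + ↑n - 1) n • z ^ n by rw [hh]; exact h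
  funext n
  rw [smul_eq_mul]
  congr 1
  have h2 : Ring.choose (b + n - 1) n = Ring.multichoose b n := by
    rw [Ring.choose]; congr 1; ring
  have h3 := Ring.factorial_nsmul_multichoose_eq_ascPochhammer b n
  rw [h2, div_eq_iff (by exact_mod_cast n.factorial_ne_zero), mul_comm, ← nsmul_eq_mul, h3]
  clear h h2 h3
  induction n with
  | zero => simp [cpoch_zero]
  | succ k ih =>
    rw [cpoch_succ, ih, Polynomial.ascPochhammer_smeval_eq_eval,
      Polynomial.ascPochhammer_smeval_eq_eval, ascPochhammer_succ_eval]

lemma Gamma_cpoch (u : ℂ) (hu : 0 < u.re) (k : ℕ) :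
    Complex.Gamma (u + k) = Complex.Gamma u * cpoch u k := by
  induction k with
  | zero => simp [cpoch_zero]
  | succ k ih =>
    have hne : u + k ≠ 0 := by
      intro h
      have := congrArg Complex.re h
      simp at this
      have : (0:ℝ) ≤ k := by positivity
      linarith
    push_cast
    rw [← add_assoc, Complex.Gamma_add_one _ hne, ih, cpoch_succ]; ring

lemma cpoch_ne (u : ℂ) (hu : 0 < u.re) (k : ℕ) : cpoch u k ≠ 0 := by
  have h : 0 < (u + k).re := by simp; positivity
  have := Complex.Gamma_ne_zero_of_re_pos h
  rw [Gamma_cpoch u hu] at this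
  exact right_ne_zero_of_mul this

lemma beta_shift (u v : ℂ) (hu : 0 < u.re) (hv : 0 < v.re) (k : ℕ) :
    Complex.betaIntegral (u + k) v
      = Complex.betaIntegral u v * (cpoch u k / cpoch (u + v) k) := by
  have huv : 0 < (u + v).re := by simp; positivity
  have h1 := Complex.Gamma_mul_Gamma_eq_betaIntegral hu hv
  have h2 := Complex.Gamma_mul_Gamma_eq_betaIntegral (s := u + k) (t := v)
    (by simp; positivity) hv
  rw [show u + k + v = u + v + k by ring, Gamma_cpoch u hu, Gamma_cpoch _ huv] at h2
  have := cpoch_ne _ huv k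
  have h3 := Complex.Gamma_ne_zero_of_re_pos huv
  rw [mul_div_assoc', eq_div_iff this]
  apply mul_left_cancel₀ h3
  linear_combination -h2 + cpoch u k * h1

lemma bound_summable (N : ℕ) (x y : ℝ) (hx : |x| < 1) (hy : |y| < 1) :
    Summable (fun p : ℕ × ℕ => (((p.1 + N).choose N : ℝ) * |x| ^ p.1) *
      (((p.2 + N).choose N : ℝ) * |y| ^ p.2)) := by
  apply Summable.mul_of_nonneg
    (summable_choose_mul_geometric_of_norm_lt_one N (by simpa using hx))
    (summable_choose_mul_geometric_of_norm_lt_one N (by simpa using hy))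
  · intro n; simp; positivity
  · intro n; simp; positivity

lemma euler (α v b₁ b₂ : ℂ) (x y : ℝ) (hα : 0 < α.re) (hv : 0 < v.re)
    (hx : |x| < 1) (hy : |y| < 1) :
    Complex.betaIntegral α v * appellF1 α b₁ b₂ (α + v) x y =
      ∫ t : ℝ in Set.Ioo 0 1, ((t : ℂ) ^ (α - 1) * (1 - (t:ℂ)) ^ (v - 1)) *
        ((1 - (x * t : ℂ)) ^ (-b₁) * (1 - (y * t : ℂ)) ^ (-b₂)) := by
  obtain ⟨N, hN⟩ := exists_nat_ge (max ‖b₁‖ ‖b₂‖)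
  have hN1 : ‖b₁‖ ≤ N + 1 := by linarith [le_max_left ‖b₁‖ ‖b₂‖]
  have hN2 : ‖b₂‖ ≤ N + 1 := by linarith [le_max_right ‖b₁‖ ‖b₂‖]
  have hint : ∀ u : ℂ, 0 < u.re → IntegrableOn
      (fun t : ℝ => (t : ℂ) ^ (u - 1) * (1 - (t:ℂ)) ^ (v - 1)) (Set.Ioo 0 1) := by
    intro u hu
    have := Complex.betaIntegral_convergent hu hv
    rw [intervalIntegrable_iff_integrableOn_Ioo_of_le zero_le_one] at this
    exact this
  have hbeta : ∀ u : ℂ, Complex.betaIntegral u v =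
      ∫ t : ℝ in Set.Ioo 0 1, (t : ℂ) ^ (u - 1) * (1 - (t:ℂ)) ^ (v - 1) := by
    intro u
    rw [Complex.betaIntegral, intervalIntegral.integral_of_le zero_le_one,
      integral_Ioc_eq_integral_Ioo]
  set u : ℕ × ℕ → ℝ := fun p => (((p.1 + N).choose N : ℝ) * |x| ^ p.1) *
      (((p.2 + N).choose N : ℝ) * |y| ^ p.2) with hu
  have hus : Summable u := bound_summable N x y hx hy
  set w : ℝ → ℂ := fun t => (t : ℂ) ^ (α - 1) * (1 - (t:ℂ)) ^ (v - 1) with hw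
  set F : ℕ × ℕ → ℝ → ℂ := fun p t => w t *
    ((cpoch b₁ p.1 / (p.1 ! : ℂ) * (x * t : ℂ) ^ p.1) *
      (cpoch b₂ p.2 / (p.2 ! : ℂ) * (y * t : ℂ) ^ p.2)) with hF
  have key : HasSum (fun p => ∫ t : ℝ in Set.Ioo 0 1, F p t)
      (∫ t : ℝ in Set.Ioo 0 1, w t *
        ((1 - (x * t : ℂ)) ^ (-b₁) * (1 - (y * t : ℂ)) ^ (-b₂))) := by
    have hb : ∀ (b : ℂ) (z : ℝ) (t : ℝ), ‖b‖ ≤ N + 1 → t ∈ Set.Ioo (0:ℝ) 1 → ∀ n : ℕ,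
        ‖cpoch b n / (n ! : ℂ) * (z * t : ℂ) ^ n‖ ≤ ((n + N).choose N : ℝ) * |z| ^ n := by
      intro b z t hb ht n
      rw [norm_mul]
      gcongr
      · exact cpoch_norm_le b N hb n
      · rw [norm_pow, norm_mul, Complex.norm_real, Complex.norm_real, Real.norm_eq_abs,
          Real.norm_eq_abs, abs_of_pos ht.1]
        exact pow_le_pow_left₀ (mul_nonneg (abs_nonneg z) ht.1.le)
          (mul_le_of_le_one_right (abs_nonneg z) ht.2.le) n
    apply hasSum_integral_of_dominated_convergence (fun p t => ‖w t‖ * u p)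
    · intro p
      refine (hint α hα).aestronglyMeasurable.mul ?_
      apply Continuous.aestronglyMeasurable
      fun_prop
    · intro p
      filter_upwards [ae_restrict_mem measurableSet_Ioo] with t ht
      simp only [hF, hu]
      rw [norm_mul]
      refine mul_le_mul_of_nonneg_left ?_ (norm_nonneg _)
      rw [norm_mul]
      exact mul_le_mul (hb b₁ x t hN1 ht p.1) (hb b₂ y t hN2 ht p.2) (norm_nonneg _)
        (by positivity)
    · exact Filter.Eventually.of_forall fun t => hus.mul_left _
    · simp_rw [tsum_mul_left]
      exact (hint α hα).norm.mul_const _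
    · filter_upwards [ae_restrict_mem measurableSet_Ioo] with t ht
      have hz : ∀ z : ℝ, |z| < 1 → ‖(z * t : ℂ)‖ < 1 := by
        intro z hz
        rw [norm_mul, Complex.norm_real, Complex.norm_real, Real.norm_eq_abs,
          Real.norm_eq_abs, abs_of_pos ht.1]
        exact (mul_le_of_le_one_right (abs_nonneg z) ht.2.le).trans_lt hz
      have hs : Summable (fun p : ℕ × ℕ =>
          ((cpoch b₁ p.1 / (p.1 ! : ℂ) * (x * t : ℂ) ^ p.1) *
          (cpoch b₂ p.2 / (p.2 ! : ℂ) * (y * t : ℂ) ^ p.2))) := by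
        refine Summable.of_norm_bounded hus ?_
        intro p
        rw [norm_mul]
        exact mul_le_mul (hb b₁ x t hN1 ht p.1) (hb b₂ y t hN2 ht p.2) (norm_nonneg _)
          (by positivity)
      have h1 := binom_hasSum b₁ _ (hz x hx)
      have h2 := binom_hasSum b₂ _ (hz y hy)
      exact (h1.mul h2 hs).mul_left (w t)
  rw [← key.tsum_eq, appellF1, ← tsum_mul_left]
  congr 1
  ext p
  have : ∫ t : ℝ in Set.Ioo 0 1, F p t = ∫ t : ℝ in Set.Ioo 0 1,
      (cpoch b₁ p.1 / (p.1 ! : ℂ) * cpoch b₂ p.2 / (p.2 ! : ℂ) * x ^ p.1 * y ^ p.2) *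
      ((t : ℂ) ^ ((α + (p.1 + p.2 : ℕ)) - 1) * (1 - (t:ℂ)) ^ (v - 1)) := by
    apply setIntegral_congr_fun measurableSet_Ioo
    intro t ht
    have ht0 : (t : ℂ) ≠ 0 := by exact_mod_cast ht.1.ne'
    simp only [hF, hw]
    rw [show α + ((p.1 + p.2 : ℕ) : ℂ) - 1 = (α - 1) + ((p.1 + p.2 : ℕ) : ℂ) by ring,
      Complex.cpow_add _ _ ht0, Complex.cpow_natCast, pow_add, mul_pow, mul_pow]
    ring
  rw [this, integral_const_mul, ← hbeta, beta_shift α v hα hv]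
  simp only [div_eq_mul_inv, mul_inv]
  ring

noncomputable def SS (t : ℝ) : ℝ := (125/256) * t^2 * (1 + t/80)^3 / (1 - 5*t/32)^4

noncomputable def QQ (t : ℝ) : ℝ := 1 + 3*t/16 - t^2/1024

noncomputable def SS' (t : ℝ) : ℝ := (125/128) * t * (1 + t/80)^2 * QQ t / (1 - 5*t/32)^5

lemma QQ_pos {t : ℝ} (h0 : 0 ≤ t) (h1 : t ≤ 1) : 0 < QQ t := by
  unfold QQ; nlinarith

lemma SS_deriv {t : ℝ} (h1 : t ≤ 1) : HasDerivAt SS (SS' t) t := by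
  have h3 : (1 - 5*t/32) ≠ 0 := by linarith
  have hn : HasDerivAt (fun t : ℝ => (125/256) * t^2 * (1 + t/80)^3)
      ((125/256) * (2 * t) * (1 + t/80)^3 + (125/256) * t^2 * (3 * (1 + t/80)^2 * (1/80))) t := by
    have e1 : HasDerivAt (fun t : ℝ => (125/256) * t^2) ((125/256) * (2*t)) t := by
      simpa using (hasDerivAt_pow 2 t).const_mul (125/256 : ℝ)
    have e2 : HasDerivAt (fun t : ℝ => (1 + t/80)^3) (3 * (1 + t/80)^2 * (1/80)) t := by
      have := (((hasDerivAt_id t).div_const 80).const_add 1).pow 3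
      refine HasDerivAt.congr_deriv (f := fun t : ℝ => (1 + t/80)^3) this ?_
      simp
    exact e1.mul e2
  have hd : HasDerivAt (fun t : ℝ => (1 - 5*t/32)^4) (4 * (1 - 5*t/32)^3 * (-(5/32))) t := by
    have := ((((hasDerivAt_id t).const_mul 5).div_const 32).const_sub 1).pow 4
    refine HasDerivAt.congr_deriv (f := fun t : ℝ => (1 - 5*t/32)^4) this ?_
    simp
  have := hn.div hd (pow_ne_zero 4 h3)
  refine this.congr_deriv ?_
  unfold SS' QQ
  have h3' : (32 - 5*t) ≠ 0 := by linarith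
  field_simp
  ring

lemma one_sub_SS {t : ℝ} (h1 : t ≤ 1) : 1 - SS t = (1 - t) * QQ t ^ 2 / (1 - 5*t/32)^4 := by
  have h3 : (1 - 5*t/32) ≠ 0 := by linarith
  have h3' : (32 - 5*t) ≠ 0 := by linarith
  unfold SS QQ
  rw [eq_div_iff (pow_ne_zero 4 h3), sub_mul, div_mul_cancel₀ _ (pow_ne_zero 4 h3)]
  ring

lemma SS'_pos {t : ℝ} (h0 : 0 < t) (h1 : t ≤ 1) : 0 < SS' t := by
  have := QQ_pos h0.le h1
  have h3 : 0 < (1 - 5*t/32) := by linarith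
  unfold SS'; positivity

lemma SS_contOn : ContinuousOn SS (Set.Icc 0 1) := fun _ ht =>
  (SS_deriv ht.2).continuousAt.continuousWithinAt

lemma SS_mono : StrictMonoOn SS (Set.Icc 0 1) := by
  apply strictMonoOn_of_deriv_pos (convex_Icc 0 1) SS_contOn
  intro t ht
  rw [interior_Icc] at ht
  rw [(SS_deriv ht.2.le).deriv]
  exact SS'_pos ht.1 ht.2.le

lemma SS_zero : SS 0 = 0 := by norm_num [SS]
lemma SS_one : SS 1 = 1 := by norm_num [SS]

lemma SS_image : SS '' Set.Ioo 0 1 = Set.Ioo 0 1 := by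
  apply Set.Subset.antisymm
  · rintro _ ⟨t, ht, rfl⟩
    constructor
    · rw [← SS_zero]
      exact SS_mono (by simp) ⟨ht.1.le, ht.2.le⟩ ht.1
    · conv_rhs => rw [← SS_one]
      exact SS_mono ⟨ht.1.le, ht.2.le⟩ (by simp) ht.2
  · have := intermediate_value_Ioo zero_le_one SS_contOn
    rwa [SS_zero, SS_one] at this

lemma cpow_exp {x : ℝ} (hx : 0 < x) (c : ℂ) :
    (x : ℂ) ^ c = Complex.exp ((Real.log x : ℂ) * c) := by
  rw [Complex.cpow_def_of_ne_zero (by exact_mod_cast hx.ne'), Complex.ofReal_log hx.le]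

lemma pointwise (a : ℂ) {t : ℝ} (h0 : 0 < t) (h1 : t < 1) :
    (SS' t : ℂ) * (((SS t : ℝ) : ℂ) ^ (a - 1) * (1 - ((SS t : ℝ) : ℂ)) ^ ((1/2 : ℂ) - 1)) =
    (2 * ((125/256 : ℝ) : ℂ) ^ a) *
      (((t : ℂ) ^ (2*a - 1) * (1 - (t:ℂ)) ^ ((1/2 : ℂ) - 1)) *
        ((1 - (((-1/80 : ℝ) : ℂ) * t : ℂ)) ^ (-(1 - 3*a)) *
          (1 - (((5/32 : ℝ) : ℂ) * t : ℂ)) ^ (-(4*a - 1)))) := by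
  have hQ := QQ_pos h0.le h1.le
  have h3 : 0 < 1 - 5*t/32 := by linarith
  have h2 : 0 < 1 + t/80 := by linarith
  have h4 : 0 < 1 - t := by linarith
  have hS : 0 < SS t := by unfold SS; positivity
  have hS1 : 0 < 1 - SS t := by rw [one_sub_SS h1.le]; positivity
  have e1 : (1 - ((SS t : ℝ) : ℂ)) = ((1 - SS t : ℝ) : ℂ) := by push_cast; ring
  have e2 : (1 - (t : ℂ)) = ((1 - t : ℝ) : ℂ) := by push_cast; ring
  have e3 : (1 - (((-1/80 : ℝ) : ℂ) * t : ℂ)) = ((1 + t/80 : ℝ) : ℂ) := by push_cast; ring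
  have e4 : (1 - (((5/32 : ℝ) : ℂ) * t : ℂ)) = ((1 - 5*t/32 : ℝ) : ℂ) := by push_cast; ring
  have lS : Real.log (SS t) = Real.log (125/256) + 2 * Real.log t + 3 * Real.log (1 + t/80)
      - 4 * Real.log (1 - 5*t/32) := by
    unfold SS
    rw [Real.log_div (by positivity) (by positivity), Real.log_mul (by positivity) (by positivity),
      Real.log_mul (by positivity) (by positivity), Real.log_pow, Real.log_pow, Real.log_pow]
    norm_num
  have lS1 : Real.log (1 - SS t) = Real.log (1 - t) + 2 * Real.log (QQ t)
      - 4 * Real.log (1 - 5*t/32) := by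
    rw [one_sub_SS h1.le]
    rw [Real.log_div (by positivity) (by positivity), Real.log_mul (by positivity) (by positivity),
      Real.log_pow, Real.log_pow]
    norm_num
  have hS' : SS' t = 2 * Real.exp (Real.log (125/256) + Real.log t + 2 * Real.log (1 + t/80)
      + Real.log (QQ t) - 5 * Real.log (1 - 5*t/32)) := by
    have l : Real.log ((125/256) * t * (1 + t/80)^2 * QQ t / (1 - 5*t/32)^5) =
       Real.log (125/256) + Real.log t + 2 * Real.log (1 + t/80)
      + Real.log (QQ t) - 5 * Real.log (1 - 5*t/32) := by
      rw [Real.log_div (by positivity) (by positivity),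
        Real.log_mul (by positivity) (by positivity),
        Real.log_mul (by positivity) (by positivity),
        Real.log_mul (by positivity) (by positivity), Real.log_pow, Real.log_pow]
      norm_num
    rw [← l, Real.exp_log (by positivity)]
    unfold SS'; ring
  rw [e1, e2, e3, e4, cpow_exp hS, cpow_exp hS1, cpow_exp h0, cpow_exp h4, cpow_exp h2,
    cpow_exp h3, cpow_exp (by norm_num), hS', lS, lS1]
  push_cast
  simp only [mul_assoc, ← Complex.exp_add]
  congr 2
  ring

lemma subst (a : ℂ) :
    Complex.betaIntegral a (1/2) = (2 * ((125/256 : ℝ) : ℂ) ^ a) *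
      ∫ t : ℝ in Set.Ioo 0 1, ((t : ℂ) ^ (2*a - 1) * (1 - (t:ℂ)) ^ ((1/2 : ℂ) - 1)) *
        ((1 - (((-1/80 : ℝ) : ℂ) * t : ℂ)) ^ (-(1 - 3*a)) *
          (1 - (((5/32 : ℝ) : ℂ) * t : ℂ)) ^ (-(4*a - 1))) := by
  rw [Complex.betaIntegral, intervalIntegral.integral_of_le zero_le_one,
      integral_Ioc_eq_integral_Ioo]
  nth_rewrite 1 [← SS_image]
  rw [integral_image_eq_integral_abs_deriv_smul measurableSet_Ioo
    (fun t ht => (SS_deriv ht.2.le).hasDerivWithinAt)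
    (SS_mono.injOn.mono Set.Ioo_subset_Icc_self), ← integral_const_mul]
  apply setIntegral_congr_fun measurableSet_Ioo
  intro t ht
  simp only
  rw [← pointwise a ht.1 ht.2, abs_of_pos (SS'_pos ht.1 ht.2.le), Complex.real_smul]

lemma main_pos (a : ℂ) (ha : 0 < a.re) :
    appellF1 (2*a) (1 - 3*a) (4*a - 1) (2*a + 1/2) (-1/80) (5/32) =
      (2:ℂ) ^ (6*a) / (5:ℂ) ^ (3*a) *
        (Real.sqrt Real.pi : ℂ) * Complex.Gamma (2*a + 1/2) / Complex.Gamma (a + 1/2) ^ 2 := by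
  have h2a : 0 < (2*a).re := by simp [ha]
  have hh : 0 < (1/2 : ℂ).re := by norm_num
  have hah : 0 < (a + 1/2).re := by rw [Complex.add_re]; positivity
  have h2ah : 0 < (2*a + 1/2).re := by rw [Complex.add_re]; positivity
  have E := euler (2*a) (1/2) (1 - 3*a) (4*a - 1) (-1/80) (5/32) h2a hh
    (by rw [abs_lt]; norm_num) (by rw [abs_lt]; norm_num)
  have S := subst a
  rw [← E] at S
  have B1 := Complex.Gamma_mul_Gamma_eq_betaIntegral ha hh
  have B2 := Complex.Gamma_mul_Gamma_eq_betaIntegral h2a hh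
  have D := Complex.Gamma_mul_Gamma_add_half a
  have hg : Complex.Gamma (1/2) = (Real.sqrt Real.pi : ℂ) := by
    rw [Complex.Gamma_one_half_eq, Real.sqrt_eq_rpow, Complex.ofReal_cpow Real.pi_pos.le]
    norm_num
  rw [hg] at B1 B2
  have n1 := Complex.Gamma_ne_zero_of_re_pos ha
  have n2 := Complex.Gamma_ne_zero_of_re_pos h2a
  have n3 := Complex.Gamma_ne_zero_of_re_pos hah
  have n4 := Complex.Gamma_ne_zero_of_re_pos h2ah
  have n5 : (Real.sqrt Real.pi : ℂ) ≠ 0 := by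
    exact_mod_cast (Real.sqrt_pos.mpr Real.pi_pos).ne'
  have c1 : ((125/256 : ℝ) : ℂ) ^ a = (5:ℂ) ^ (3*a) / (2:ℂ) ^ (8*a) := by
    rw [cpow_exp (by norm_num), show (5:ℂ) = ((5:ℝ):ℂ) by norm_num,
      show (2:ℂ) = ((2:ℝ):ℂ) by norm_num, cpow_exp (by norm_num), cpow_exp (by norm_num),
      ← Complex.exp_sub, Real.log_div (by norm_num) (by norm_num),
      show (125:ℝ) = 5^3 by norm_num, show (256:ℝ) = 2^8 by norm_num, Real.log_pow, Real.log_pow]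
    congr 1
    push_cast
    ring
  have c2 : (2:ℂ) ^ (8*a) = (2:ℂ) ^ (6*a) * (2:ℂ) ^ (2*a) := by
    rw [← Complex.cpow_add _ _ two_ne_zero]; congr 1; ring
  have c3 : (2:ℂ) ^ (1 - 2*a) = 2 / (2:ℂ) ^ (2*a) := by
    rw [Complex.cpow_sub _ _ two_ne_zero, Complex.cpow_one]
  rw [c1, c2] at S
  rw [c3] at D
  have m1 : (2:ℂ) ^ (6*a) ≠ 0 := by simp [Complex.cpow_eq_zero_iff]
  have m2 : (2:ℂ) ^ (2*a) ≠ 0 := by simp [Complex.cpow_eq_zero_iff]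
  have m3 : (5:ℂ) ^ (3*a) ≠ 0 := by simp [Complex.cpow_eq_zero_iff]
  have hx : (((-1/80 : ℝ)) : ℂ) = -1/80 := by push_cast; rfl
  have hy : (((5/32 : ℝ)) : ℂ) = 5/32 := by push_cast; rfl
  rw [hx, hy] at S
  generalize appellF1 (2*a) (1 - 3*a) (4*a - 1) (2*a + 1/2) (-1/80) (5/32) = A at *
  generalize Complex.betaIntegral a (1/2) = b1 at *
  generalize Complex.betaIntegral (2*a) (1/2) = b2 at *
  generalize (2:ℂ) ^ (6*a) = X at *
  generalize (2:ℂ) ^ (2*a) = Y at *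
  generalize (5:ℂ) ^ (3*a) = Z at *
  generalize Complex.Gamma (2*a + 1/2) = G1 at *
  generalize Complex.Gamma (a + 1/2) = G2 at *
  generalize Complex.Gamma (2*a) = G3 at *
  generalize Complex.Gamma a = G4 at *
  generalize (Real.sqrt Real.pi : ℂ) = s at *
  clear E
  have b2e : b2 = G3 * s / G1 := by field_simp; linear_combination -B2
  have b1e : b1 = G4 * s / G2 := by field_simp; linear_combination -B1
  have g4e : G4 = G3 * (2 / Y) * s / G2 := by field_simp; field_simp at D; linear_combination D
  subst b2e b1e g4e
  field_simp at S ⊢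
  linear_combination -S

lemma norm_ratio (a : ℂ) (ha : 0 ≤ a.re) (k : ℕ) :
    ‖cpoch (2*a) k / cpoch (2*a + 1/2) k‖ ≤ 1 := by
  rw [norm_div]
  apply div_le_one_of_le₀ _ (norm_nonneg _)
  unfold cpoch
  rw [norm_prod, norm_prod]
  apply Finset.prod_le_prod (fun _ _ => norm_nonneg _)
  intro i _
  rw [Complex.norm_def, Complex.norm_def]
  apply Real.sqrt_le_sqrt
  rw [Complex.normSq_apply, Complex.normSq_apply]
  have : (0:ℝ) ≤ i := by positivity
  simp
  nlinarith

lemma cont (R : ℝ) : ContinuousOn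
    (fun a : ℂ => appellF1 (2*a) (1 - 3*a) (4*a - 1) (2*a + 1/2) (-1/80) (5/32))
    ({a : ℂ | 0 ≤ a.re} ∩ Metric.closedBall 0 R) := by
  obtain ⟨N, hN⟩ := exists_nat_ge (4 * R)
  unfold appellF1
  refine continuousOn_tsum (u := fun p : ℕ × ℕ => (((p.1 + N).choose N : ℝ) * |(-1/80:ℝ)| ^ p.1) *
      (((p.2 + N).choose N : ℝ) * |(5/32:ℝ)| ^ p.2)) ?_
    (bound_summable N _ _ (by rw [abs_lt]; norm_num) (by rw [abs_lt]; norm_num)) ?_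
  · intro p
    have hc : ∀ k : ℕ, Continuous (fun a : ℂ => cpoch a k) := by
      intro k; unfold cpoch; fun_prop
    have hc1 := (hc (p.1 + p.2)).comp (show Continuous fun a : ℂ => 2*a by fun_prop)
    have hc2 := (hc (p.1 + p.2)).comp (show Continuous fun a : ℂ => 2*a + 1/2 by fun_prop)
    have hc3 := (hc p.1).comp (show Continuous fun a : ℂ => 1 - 3*a by fun_prop)
    have hc4 := (hc p.2).comp (show Continuous fun a : ℂ => 4*a - 1 by fun_prop)
    simp only [Function.comp_def] at hc1 hc2 hc3 hc4
    refine ((ContinuousOn.div (by fun_prop) (by fun_prop) ?_).mul continuousOn_const).mul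
      continuousOn_const
    rintro a ⟨ha, -⟩
    have ha' : 0 ≤ a.re := ha
    have : 0 < (2*a + 1/2).re := by
      rw [Complex.add_re]
      simp
      linarith
    refine mul_ne_zero (mul_ne_zero (cpoch_ne _ this _) ?_) ?_
    · exact_mod_cast p.1.factorial_ne_zero
    · exact_mod_cast p.2.factorial_ne_zero
  · rintro p a ⟨ha, hR⟩
    rw [mem_closedBall_zero_iff] at hR
    have hb1 : ‖1 - 3*a‖ ≤ N + 1 := by
      refine (norm_sub_le _ _).trans ?_
      simp
      linarith [norm_nonneg a]
    have hb2 : ‖4*a - 1‖ ≤ N + 1 := by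
      refine (norm_sub_le _ _).trans ?_
      simp
      linarith [norm_nonneg a]
    have e : cpoch (2*a) (p.1 + p.2) * cpoch (1 - 3*a) p.1 * cpoch (4*a - 1) p.2 /
      (cpoch (2*a + 1/2) (p.1 + p.2) * (p.1 ! : ℂ) * (p.2 ! : ℂ)) * (-1/80) ^ p.1 * (5/32) ^ p.2
      = (cpoch (2*a) (p.1 + p.2) / cpoch (2*a + 1/2) (p.1 + p.2)) *
        ((cpoch (1 - 3*a) p.1 / (p.1 ! : ℂ) * (-1/80) ^ p.1) *
        (cpoch (4*a - 1) p.2 / (p.2 ! : ℂ) * (5/32) ^ p.2)) := by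
      simp only [div_eq_mul_inv, mul_inv]
      ring
    rw [e, norm_mul]
    refine (mul_le_of_le_one_left (norm_nonneg _) (norm_ratio a ha _)).trans ?_
    rw [norm_mul, norm_mul, norm_mul, norm_pow, norm_pow]
    have x1 : ‖(-1/80 : ℂ)‖ = |(-1/80:ℝ)| := by
      rw [← Real.norm_eq_abs, ← Complex.norm_real]; norm_num
    have x2 : ‖(5/32 : ℂ)‖ = |(5/32:ℝ)| := by
      rw [← Real.norm_eq_abs, ← Complex.norm_real]; norm_num
    rw [x1, x2]
    have := cpoch_norm_le _ N hb1 p.1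
    have := cpoch_norm_le _ N hb2 p.2
    gcongr

theorem stmt16 (a : ℂ) (ha : 0 ≤ a.re)
    (hpole : ∀ n : ℕ, a + 1/2 ≠ -(n : ℂ)) :
    appellF1 (2*a) (1 - 3*a) (4*a - 1) (2*a + 1/2) (-1/80) (5/32) =
      (2:ℂ) ^ (6*a) / (5:ℂ) ^ (3*a) *
        (Real.sqrt Real.pi : ℂ) * Complex.Gamma (2*a + 1/2) / Complex.Gamma (a + 1/2) ^ 2 := by
  have hu : Filter.Tendsto (fun n : ℕ => a + ((1 / ((n:ℝ) + 1) : ℝ) : ℂ)) Filter.atTop (nhds a) := by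
    have h := (Complex.continuous_ofReal.tendsto 0).comp
      (tendsto_one_div_add_atTop_nhds_zero_nat (𝕜 := ℝ))
    simpa using h.const_add a
  have hre : ∀ n : ℕ, 0 < (a + ((1 / ((n:ℝ) + 1) : ℝ) : ℂ)).re := by
    intro n
    rw [Complex.add_re, Complex.ofReal_re]
    positivity
  have hmem : ∀ n : ℕ, a + ((1 / ((n:ℝ) + 1) : ℝ) : ℂ) ∈
      ({a : ℂ | 0 ≤ a.re} ∩ Metric.closedBall 0 (‖a‖ + 1)) := by
    intro n
    refine ⟨(hre n).le, ?_⟩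
    rw [mem_closedBall_zero_iff]
    refine (norm_add_le _ _).trans ?_
    rw [Complex.norm_real, Real.norm_of_nonneg (by positivity)]
    gcongr
    rw [div_le_one (by positivity)]
    have : (0:ℝ) ≤ n := by positivity
    linarith
  have hL := (cont (‖a‖ + 1) a ⟨ha, by simp⟩).tendsto.comp
    (tendsto_nhdsWithin_iff.mpr ⟨hu, Filter.Eventually.of_forall hmem⟩)
  have hG : ∀ z : ℂ, 0 < z.re → ContinuousAt Complex.Gamma z := by
    intro z hz
    refine (Complex.differentiableAt_Gamma z ?_).continuousAt
    intro m h
    have := congrArg Complex.re h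
    simp at this
    have : (0:ℝ) ≤ m := by positivity
    linarith
  have h1 : 0 < (a + 1/2).re := by rw [Complex.add_re]; norm_num; linarith
  have h2 : 0 < (2*a + 1/2).re := by rw [Complex.add_re]; norm_num; linarith
  have hR : ContinuousAt (fun a : ℂ => (2:ℂ) ^ (6*a) / (5:ℂ) ^ (3*a) *
        (Real.sqrt Real.pi : ℂ) * Complex.Gamma (2*a + 1/2) / Complex.Gamma (a + 1/2) ^ 2) a := by
    have c1 : ContinuousAt (fun a : ℂ => Complex.Gamma (2*a + 1/2)) a :=
      ContinuousAt.comp (f := fun a : ℂ => 2*a + 1/2) (hG _ h2) (by fun_prop)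
    have c2 : ContinuousAt (fun a : ℂ => Complex.Gamma (a + 1/2)) a :=
      ContinuousAt.comp (f := fun a : ℂ => a + 1/2) (hG _ h1) (by fun_prop)
    have c3 : ContinuousAt (fun a : ℂ => (2:ℂ) ^ (6*a)) a :=
      ContinuousAt.const_cpow (by fun_prop) (Or.inl two_ne_zero)
    have c4 : ContinuousAt (fun a : ℂ => (5:ℂ) ^ (3*a)) a :=
      ContinuousAt.const_cpow (by fun_prop) (Or.inl (by norm_num))
    refine ContinuousAt.div₀ ?_ (c2.pow 2) (pow_ne_zero 2 (Complex.Gamma_ne_zero_of_re_pos h1))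
    refine ((c3.div₀ c4 ?_).mul continuousAt_const).mul c1
    simp [Complex.cpow_eq_zero_iff]
  refine tendsto_nhds_unique hL ?_
  refine (hR.tendsto.comp hu).congr ?_
  intro n
  exact (main_pos _ (hre n)).symm
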